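/- arXiv:1912.11436 — 3 statements merged into one kernel-verified Lean document; each statement's English description precedes it below -/
import Mathlib

section
/- (Theorem 2, crossfit LRT) Let U_n^swap be defined as U_n but with the roles of D₀ and D₁ swapped (an estimator θ̂₀' measurable with respect to D₀, and a null maximizer over Θ₀ of the likelihood evaluated on D₁), and let W_n = (U_n + U_n^swap)/2. Then the crossfit LRT, which rejects H₀ when W_n > 1/α, satisfies sup_{θ* ∈ Θ₀} P_{θ*}(W_n > 1/α) ≤ α for any α ∈ (0,1). -/
open MeasureTheory
open scoped ENNReal

/-- The expected likelihood ratio `q / f` under the density `f` is at most `∫⁻ q`. -/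
theorem lintegral_div_withDensity_le {𝒴 : Type*} [MeasurableSpace 𝒴] (μ : Measure 𝒴)
    {f q : 𝒴 → ℝ≥0∞} (hf : Measurable f) (hq : Measurable q) :
    ∫⁻ y, q y / f y ∂μ.withDensity f ≤ ∫⁻ y, q y ∂μ := by
  rw [lintegral_withDensity_eq_lintegral_mul μ hf (hq.fun_div hf)]
  exact lintegral_mono fun y => ENNReal.mul_div_le

/-- The expected likelihood ratio of an i.i.d. sample from the density `f` against a density `q`
is at most one. -/
theorem lintegral_prod_div_prod_le_one {𝒴 ι : Type*} [MeasurableSpace 𝒴] [Fintype ι]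
    (μ : Measure 𝒴) {f q : 𝒴 → ℝ≥0∞} (hf : Measurable f) (hq : Measurable q)
    [IsProbabilityMeasure (μ.withDensity f)] (hq1 : ∫⁻ y, q y ∂μ ≤ 1) :
    ∫⁻ d : ι → 𝒴, (∏ i, q (d i)) / (∏ i, f (d i))
      ∂(Measure.pi fun _ : ι => μ.withDensity f) ≤ 1 := by
  have hpos : ∀ᵐ d : ι → 𝒴 ∂(Measure.pi fun _ : ι => μ.withDensity f), ∀ i, f (d i) ≠ 0 :=
    Filter.eventually_all.2 fun i =>
      (measurePreserving_eval (fun _ : ι => μ.withDensity f) i).quasiMeasurePreserving.ae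
        ((ae_withDensity_iff hf (p := fun y => f y ≠ 0)).2 (.of_forall fun _ h => h))
  have hratio : Measurable fun y => q y / f y := hq.div hf
  calc _ = ∫⁻ d : ι → 𝒴, ∏ i, q (d i) / f (d i)
        ∂(Measure.pi fun _ : ι => μ.withDensity f) := by
        refine lintegral_congr_ae ?_
        filter_upwards [hpos] with d hd
        simp only [div_eq_mul_inv, Finset.prod_mul_distrib]
        rw [ENNReal.prod_inv_distrib fun i _ _ _ _ => Or.inl (hd i)]
    _ = ∏ i : ι, ∫⁻ d : ι → 𝒴, q (d i) / f (d i)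
        ∂(Measure.pi fun _ : ι => μ.withDensity f) :=
        ProbabilityTheory.lintegral_prod_eq_prod_lintegral_of_indepFun Finset.univ _
          (ProbabilityTheory.iIndepFun_pi fun _ => hratio.aemeasurable)
          fun i => hratio.comp (measurable_pi_apply i)
    _ ≤ 1 := by
        refine Finset.prod_le_one' fun i _ => ?_
        rw [(measurePreserving_eval (fun _ : ι => μ.withDensity f) i).lintegral_comp hratio]
        exact (lintegral_div_withDensity_le μ hf hq).trans hq1

/-- The expectation of a split likelihood ratio statistic, whose numerator is evaluated at an
estimator computed from independent data, is at most one. -/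
theorem lintegral_split_likelihood_ratio_le_one {𝒴 Θ ι Ω : Type*} [MeasurableSpace 𝒴]
    [MeasurableSpace Θ] [MeasurableSpace Ω] [Fintype ι] (μ : Measure 𝒴)
    {p : Θ → 𝒴 → ℝ≥0∞} (hp_meas : Measurable (Function.uncurry p))
    (hp1 : ∀ θ, ∫⁻ y, p θ y ∂μ ≤ 1) (θ₀ : Θ) [IsProbabilityMeasure (μ.withDensity (p θ₀))]
    (ν : Measure Ω) [IsProbabilityMeasure ν] (est : Ω → Θ) :
    ∫⁻ ω, ∫⁻ d : ι → 𝒴, (∏ i, p (est ω) (d i)) / (∏ i, p θ₀ (d i))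
      ∂(Measure.pi fun _ : ι => μ.withDensity (p θ₀)) ∂ν ≤ 1 := by
  calc _ ≤ ∫⁻ _, 1 ∂ν := lintegral_mono fun ω =>
        lintegral_prod_div_prod_le_one μ hp_meas.of_uncurry_left hp_meas.of_uncurry_left
          (hp1 (est ω))
    _ = 1 := by simp

/-- **Theorem 2, crossfit LRT.** Let `Uₙ = L₀(θ̂₁)/L₀(θ̂₀)` be the split LRT
statistic (estimator `hat1 D₁` from `D₁`, null MLE `mle0 D₀ ∈ Θ₀` on `D₀`), and let
`Uₙ^swap` be its swapped version (estimator `hat0 D₀` from `D₀`, null MLE `mle1 D₁ ∈ Θ₀`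
of the likelihood evaluated on `D₁`).  Then `Wₙ = (Uₙ + Uₙ^swap)/2` satisfies
`P_{θ*}(Wₙ > 1/α) ≤ α` for every `θ* ∈ Θ₀`. -/
theorem crossfit_LRT_type_I_error
    {𝒴 Θ : Type*} [MeasurableSpace 𝒴] [MeasurableSpace Θ]
    (μ : Measure 𝒴) [SigmaFinite μ] (n : ℕ)
    (p : Θ → 𝒴 → ℝ≥0∞) (hp_meas : Measurable (Function.uncurry p))
    (hp1 : ∀ θ, ∫⁻ y, p θ y ∂μ = 1)
    [∀ θ, IsProbabilityMeasure (μ.withDensity (p θ))]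
    (Θ₀ : Set Θ)
    (hat1 : (Fin n → 𝒴) → Θ) (hhat1 : Measurable hat1)
    (hat0 : (Fin n → 𝒴) → Θ) (hhat0 : Measurable hat0)
    (mle0 : (Fin n → 𝒴) → Θ) (hmle0_meas : Measurable mle0)
    (hmle0_mem : ∀ d : Fin n → 𝒴, mle0 d ∈ Θ₀)
    (hmle0_max : ∀ d : Fin n → 𝒴, ∀ θ ∈ Θ₀, (∏ i, p θ (d i)) ≤ ∏ i, p (mle0 d) (d i))
    (mle1 : (Fin n → 𝒴) → Θ) (hmle1_meas : Measurable mle1)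
    (hmle1_mem : ∀ d : Fin n → 𝒴, mle1 d ∈ Θ₀)
    (hmle1_max : ∀ d : Fin n → 𝒴, ∀ θ ∈ Θ₀, (∏ i, p θ (d i)) ≤ ∏ i, p (mle1 d) (d i))
    (θstar : Θ) (hθstar : θstar ∈ Θ₀)
    (α : ℝ) (hα : α ∈ Set.Ioo (0 : ℝ) 1) :
    ((Measure.pi fun _ : Fin n => μ.withDensity (p θstar)).prod
        (Measure.pi fun _ : Fin n => μ.withDensity (p θstar)))
        {ω : (Fin n → 𝒴) × (Fin n → 𝒴) |
          ENNReal.ofReal (1 / α) <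
            ((∏ i, p (hat1 ω.2) (ω.1 i)) / (∏ i, p (mle0 ω.1) (ω.1 i))
              + (∏ i, p (hat0 ω.1) (ω.2 i)) / (∏ i, p (mle1 ω.2) (ω.2 i))) / 2}
      ≤ ENNReal.ofReal α := by
  have hlik : ∀ {est : (Fin n → 𝒴) → Θ}, Measurable est →
      Measurable fun ω : (Fin n → 𝒴) × (Fin n → 𝒴) =>
        (∏ i, p (est ω.2) (ω.1 i)) / (∏ i, p θstar (ω.1 i)) := by
    intro est hest
    refine (Finset.measurable_prod _ fun i _ => ?_).div (Finset.measurable_prod _ fun i _ => ?_)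
    · exact hp_meas.comp (f := fun ω : (Fin n → 𝒴) × (Fin n → 𝒴) => (est ω.2, ω.1 i))
        (by fun_prop)
    · exact (hp_meas.of_uncurry_left (x := θstar)).comp (by fun_prop)
  have hR := hlik hhat1
  have hS : Measurable fun ω : (Fin n → 𝒴) × (Fin n → 𝒴) =>
      (∏ i, p (hat0 ω.1) (ω.2 i)) / (∏ i, p θstar (ω.2 i)) := (hlik hhat0).comp measurable_swap
  set P := Measure.pi fun _ : Fin n => μ.withDensity (p θstar)
  set W : (Fin n → 𝒴) × (Fin n → 𝒴) → ℝ≥0∞ := fun ω =>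
    ((∏ i, p (hat1 ω.2) (ω.1 i)) / (∏ i, p θstar (ω.1 i))
      + (∏ i, p (hat0 ω.1) (ω.2 i)) / (∏ i, p θstar (ω.2 i))) / 2 with hW
  have hWmeas : Measurable W := (hR.add hS).div_const 2
  have hWint : ∫⁻ ω, W ω ∂(P.prod P) ≤ 1 := by
    have hRint : ∫⁻ ω, (∏ i, p (hat1 ω.2) (ω.1 i)) / (∏ i, p θstar (ω.1 i)) ∂(P.prod P) ≤ 1 := by
      rw [lintegral_prod_symm' _ hR]
      exact lintegral_split_likelihood_ratio_le_one μ hp_meas (fun θ => (hp1 θ).le) θstar P hat1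
    have hSint : ∫⁻ ω, (∏ i, p (hat0 ω.1) (ω.2 i)) / (∏ i, p θstar (ω.2 i)) ∂(P.prod P) ≤ 1 := by
      rw [lintegral_prod _ hS.aemeasurable]
      exact lintegral_split_likelihood_ratio_le_one μ hp_meas (fun θ => (hp1 θ).le) θstar P hat0
    simp only [hW, div_eq_mul_inv _ (2 : ℝ≥0∞)]
    rw [lintegral_mul_const _ (hR.fun_add hS), lintegral_add_left hR, ← div_eq_mul_inv]
    refine ENNReal.div_le_of_le_mul ?_
    rw [one_mul, ← one_add_one_eq_two]
    exact add_le_add hRint hSint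
  have hα0 : ENNReal.ofReal α ≠ 0 := by simpa using hα.1
  have hinv : ENNReal.ofReal (1 / α) = (ENNReal.ofReal α)⁻¹ := by
    rw [one_div, ENNReal.ofReal_inv_of_pos hα.1]
  calc _ ≤ (P.prod P) {ω | (ENNReal.ofReal α)⁻¹ ≤ W ω} := by
        refine measure_mono fun ω hω => ?_
        rw [← hinv]
        refine (le_of_lt hω).trans (ENNReal.div_le_div_right (add_le_add ?_ ?_) 2)
        · exact ENNReal.div_le_div_left (hmle0_max ω.1 θstar hθstar) _
        · exact ENNReal.div_le_div_left (hmle1_max ω.2 θstar hθstar) _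
    _ ≤ (∫⁻ ω, W ω ∂(P.prod P)) / (ENNReal.ofReal α)⁻¹ :=
        meas_ge_le_lintegral_div hWmeas.aemeasurable (by simp) (by simpa using hα.1)
    _ ≤ ENNReal.ofReal α := by
        rw [div_eq_mul_inv, inv_inv]
        exact mul_le_of_le_one_left' hWint
end

section
/- (Proposition: coverage under misspecification) Suppose the data Y₁,…,Y_{2n} are i.i.d. with density q with respect to μ, where q need not belong to the model 𝒫_Θ = {p_θ : θ ∈ Θ}. Suppose there exists θ⁰ ∈ Θ such that p* := p_{θ⁰} satisfies E_{Y∼q}[p_θ(Y)/p*(Y)] ≤ 1 for every θ ∈ Θ (the reversed-information-projection inequality, which holds when 𝒫_Θ is convex and p* ∈ 𝒫_Θ attains inf_{θ∈Θ} K(q, p_θ)). Then the universal confidence set C_n = {θ ∈ Θ : L₀(θ̂₁)/L₀(θ) ≤ 1/α} satisfies P_q(θ⁰ ∈ C_n) ≥ 1 − α for any α ∈ (0,1) and any estimator θ̂₁ measurable with respect to D₁. -/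
open MeasureTheory
open scoped ENNReal

/-- The integral over a product probability space of a product of functions of the separate
coordinates is the product of the integrals. -/
lemma lintegral_pi_prod_eq_prod_lintegral {ι α : Type*} [Fintype ι] [MeasurableSpace α]
    (ν : Measure α) [IsProbabilityMeasure ν] {f : α → ℝ≥0∞} (hf : Measurable f) :
    ∫⁻ x, ∏ i : ι, f (x i) ∂(Measure.pi fun _ : ι => ν) = ∏ _i : ι, ∫⁻ y, f y ∂ν := by
  rw [ProbabilityTheory.lintegral_prod_eq_prod_lintegral_of_indepFun Finset.univ
    (fun i (x : ι → α) => f (x i))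
    (ProbabilityTheory.iIndepFun_pi fun _ => hf.aemeasurable)
    (fun i => hf.comp (measurable_pi_apply i))]
  refine Finset.prod_congr rfl fun i _ => ?_
  exact (measurePreserving_eval (fun _ : ι => ν) i).lintegral_comp hf

/-- If the ratio `f / g` has mean at most one, so does the likelihood ratio of an i.i.d. sample. -/
lemma lintegral_pi_prod_div_prod_le_one {ι α : Type*} [Fintype ι] [MeasurableSpace α]
    (ν : Measure α) [IsProbabilityMeasure ν] {f g : α → ℝ≥0∞} (hf : Measurable f)
    (hg : Measurable g) (hg_top : ∀ᵐ y ∂ν, g y ≠ ∞) (hfg : ∫⁻ y, f y / g y ∂ν ≤ 1) :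
    ∫⁻ x, (∏ i : ι, f (x i)) / (∏ i : ι, g (x i)) ∂(Measure.pi fun _ : ι => ν) ≤ 1 := by
  have hg_pi : ∀ᵐ x ∂(Measure.pi fun _ : ι => ν), ∀ i, g (x i) ≠ ∞ :=
    ae_all_iff.2 fun i =>
      (measurePreserving_eval (fun _ : ι => ν) i).quasiMeasurePreserving.ae hg_top
  calc ∫⁻ x, (∏ i : ι, f (x i)) / (∏ i : ι, g (x i)) ∂(Measure.pi fun _ : ι => ν)
      = ∫⁻ x, ∏ i : ι, f (x i) / g (x i) ∂(Measure.pi fun _ : ι => ν) := by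
        refine lintegral_congr_ae ?_
        filter_upwards [hg_pi] with x hx
        exact (ENNReal.prod_div_distrib fun i _ j _ _ => Or.inr (hx j)).symm
    _ = ∏ _i : ι, ∫⁻ y, f y / g y ∂ν :=
        lintegral_pi_prod_eq_prod_lintegral ν (hf.div hg)
    _ ≤ 1 := Finset.prod_le_one' fun _ _ => hfg

/-- Markov's inequality for a variable of mean at most one, stated for the complementary event. -/
lemma ofReal_one_sub_le_measure_le_of_lintegral_le_one {Ω : Type*} [MeasurableSpace Ω]
    (P : Measure Ω) [IsProbabilityMeasure P] {X : Ω → ℝ≥0∞} (hX : Measurable X)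
    (hX1 : ∫⁻ ω, X ω ∂P ≤ 1) {α : ℝ} (hα : 0 < α) :
    ENNReal.ofReal (1 - α) ≤ P {ω | X ω ≤ ENNReal.ofReal (1 / α)} := by
  have hS : MeasurableSet {ω | X ω ≤ ENNReal.ofReal (1 / α)} :=
    measurableSet_le hX measurable_const
  have hcompl : P {ω | X ω ≤ ENNReal.ofReal (1 / α)}ᶜ ≤ ENNReal.ofReal α := by
    calc P {ω | X ω ≤ ENNReal.ofReal (1 / α)}ᶜ
        ≤ P {ω | ENNReal.ofReal (1 / α) ≤ X ω} := by
          refine measure_mono fun ω hω => ?_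
          rw [Set.mem_compl_iff, Set.mem_ofPred_eq, not_le] at hω
          exact hω.le
      _ ≤ (∫⁻ ω, X ω ∂P) / ENNReal.ofReal (1 / α) :=
          meas_ge_le_lintegral_div hX.aemeasurable
            (ENNReal.ofReal_pos.2 (one_div_pos.2 hα)).ne' ENNReal.ofReal_ne_top
      _ ≤ 1 / ENNReal.ofReal (1 / α) := by gcongr
      _ = ENNReal.ofReal α := by
          rw [one_div, one_div, ENNReal.ofReal_inv_of_pos hα, inv_inv]
  rw [ENNReal.ofReal_sub 1 hα.le, ENNReal.ofReal_one, tsub_le_iff_right,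
    ← prob_add_prob_compl (μ := P) hS]
  gcongr

/-- **Coverage under misspecification.** Suppose the data are i.i.d. with
density `q` (not necessarily in the model `{p θ}`), and suppose there is `θ⁰ ∈ Θ` whose
density `p θ⁰` satisfies the reversed-information-projection inequality
`E_{Y∼q}[p θ (Y) / p θ⁰ (Y)] ≤ 1` for every `θ ∈ Θ` (which holds when the model is
convex and `p θ⁰` attains `inf_θ K(q, p θ)`).  Then the universal confidence set
`Cₙ = {θ : L₀(θ̂₁)/L₀(θ) ≤ 1/α}` satisfies `P_q(θ⁰ ∈ Cₙ) ≥ 1 − α` for any estimator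
`θ̂₁` measurable with respect to `D₁`. -/
theorem universal_set_coverage_under_misspecification
    {𝒴 Θ : Type*} [MeasurableSpace 𝒴] [MeasurableSpace Θ]
    (μ : Measure 𝒴) [SigmaFinite μ] (n : ℕ)
    (p : Θ → 𝒴 → ℝ≥0∞) (hp_meas : Measurable (Function.uncurry p))
    (hp1 : ∀ θ, ∫⁻ y, p θ y ∂μ = 1)
    (q : 𝒴 → ℝ≥0∞) (hq_meas : Measurable q) (hq1 : ∫⁻ y, q y ∂μ = 1)
    [IsProbabilityMeasure (μ.withDensity q)]
    (θ0 : Θ)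
    (hRIPR : ∀ θ : Θ, ∫⁻ y, (p θ y / p θ0 y) * q y ∂μ ≤ 1)
    (hat1 : (Fin n → 𝒴) → Θ) (hhat1 : Measurable hat1)
    (α : ℝ) (hα : α ∈ Set.Ioo (0 : ℝ) 1) :
    ENNReal.ofReal (1 - α) ≤
      ((Measure.pi fun _ : Fin n => μ.withDensity q).prod
        (Measure.pi fun _ : Fin n => μ.withDensity q))
        {ω : (Fin n → 𝒴) × (Fin n → 𝒴) |
          (∏ i, p (hat1 ω.2) (ω.1 i)) / (∏ i, p θ0 (ω.1 i)) ≤ ENNReal.ofReal (1 / α)} := by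
  have hp : ∀ θ, Measurable (p θ) := fun θ => hp_meas.of_uncurry_left
  have hp0_top : ∀ᵐ y ∂(μ.withDensity q), p θ0 y ≠ ∞ := by
    refine (withDensity_absolutelyContinuous μ q).ae_le ?_
    filter_upwards [ae_lt_top (hp θ0) (by simp [hp1])] with y hy using hy.ne
  have hratio : ∀ θ, ∫⁻ y, p θ y / p θ0 y ∂(μ.withDensity q) ≤ 1 := fun θ => by
    refine (lintegral_withDensity_eq_lintegral_mul μ hq_meas ((hp θ).div (hp θ0))).trans_le ?_
    simpa [mul_comm] using hRIPR θ
  have hX : Measurable fun ω : (Fin n → 𝒴) × (Fin n → 𝒴) =>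
      (∏ i, p (hat1 ω.2) (ω.1 i)) / (∏ i, p θ0 (ω.1 i)) := by
    refine Measurable.div (Finset.measurable_fun_prod _ fun i _ => ?_)
      (Finset.measurable_fun_prod _ fun i _ => ?_)
    · exact hp_meas.comp ((hhat1.comp measurable_snd).prodMk
        ((measurable_pi_apply i).comp measurable_fst))
    · exact (hp θ0).comp ((measurable_pi_apply i).comp measurable_fst)
  refine ofReal_one_sub_le_measure_le_of_lintegral_le_one _ hX ?_ hα.1
  rw [lintegral_prod_symm' _ hX]
  calc ∫⁻ y, ∫⁻ x, (∏ i, p (hat1 y) (x i)) / (∏ i, p θ0 (x i))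
          ∂(Measure.pi fun _ : Fin n => μ.withDensity q)
          ∂(Measure.pi fun _ : Fin n => μ.withDensity q)
      ≤ ∫⁻ _, 1 ∂(Measure.pi fun _ : Fin n => μ.withDensity q) :=
        lintegral_mono fun y => lintegral_pi_prod_div_prod_le_one _ (hp (hat1 y)) (hp θ0)
          hp0_top (hratio (hat1 y))
    _ = 1 := by simp
end

section
/- (Proposition: RIPR split LRT) Let Θ₀ ⊆ Θ and suppose {p_θ : θ ∈ Θ₀} generates a convex family. Let θ̂₁ ∈ Θ be an estimator measurable with respect to D₁, and let p₀* be a density, measurable as a function of D₁, satisfying E_{Y∼p_{θ₀}}[p_{θ̂₁}(Y)/p₀*(Y) | D₁] ≤ 1 for every θ₀ ∈ Θ₀ (the reversed information projection of p_{θ̂₁} onto the null family). Define R_n = ∏_{i∈D₀} p_{θ̂₁}(Yᵢ)/p₀*(Yᵢ). Then sup_{θ₀ ∈ Θ₀} P_{θ₀}(R_n > 1/α) ≤ α for any α ∈ (0,1). Moreover, if p₀* equals p_{θ'} for some θ' ∈ Θ₀, then R_n ≥ U_n, where U_n is the MLE split LRT statistic L₀(θ̂₁)/L₀(θ̂₀)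 with θ̂₀ the null MLE on D₀. -/
open MeasureTheory
open scoped ENNReal

/-- Under a product probability measure, a product of functions of the separate coordinates
integrates to the product of the integrals. -/
lemma lintegral_pi_prod_eq_prod {ι : Type*} [Fintype ι] {X : ι → Type*}
    [∀ i, MeasurableSpace (X i)] (ν : ∀ i, Measure (X i)) [∀ i, IsProbabilityMeasure (ν i)]
    {f : ∀ i, X i → ℝ≥0∞} (hf : ∀ i, Measurable (f i)) :
    ∫⁻ x, ∏ i, f i (x i) ∂Measure.pi ν = ∏ i, ∫⁻ y, f i y ∂ν i := by
  rw [ProbabilityTheory.lintegral_prod_eq_prod_lintegral_of_indepFun Finset.univ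
    (fun i (x : ∀ i, X i) => f i (x i))
    (ProbabilityTheory.iIndepFun_pi fun i => (hf i).aemeasurable)
    fun i => (hf i).comp (measurable_pi_apply i)]
  exact Finset.prod_congr rfl fun i _ => (measurePreserving_eval ν i).lintegral_comp (hf i)

/-- Markov's inequality for a ratio of products: if each ratio `f / g` has expectation at most one
under `ν`, then the likelihood ratio over `ν`-i.i.d. observations exceeds `c` with probability at
most `c⁻¹`. -/
lemma measure_pi_lt_prod_div_prod_le {ι Y : Type*} [Fintype ι] [MeasurableSpace Y]
    (ν : Measure Y) [IsProbabilityMeasure ν] {f g : Y → ℝ≥0∞} (hf : Measurable f)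
    (hg : Measurable g) (hg_top : ∀ᵐ y ∂ν, g y ≠ ∞) (hfg : ∫⁻ y, f y / g y ∂ν ≤ 1)
    {c : ℝ≥0∞} (hc : c ≠ 0) (hc_top : c ≠ ∞) :
    (Measure.pi fun _ : ι => ν) {x | c < (∏ i, f (x i)) / ∏ i, g (x i)} ≤ c⁻¹ := by
  have hae : ∀ᵐ x ∂(Measure.pi fun _ : ι => ν), ∀ i, g (x i) ≠ ∞ :=
    ae_all_iff.2 fun i => (measurePreserving_eval (fun _ => ν) i).quasiMeasurePreserving.ae hg_top
  have hle : ∫⁻ x, (∏ i, f (x i)) / ∏ i, g (x i) ∂(Measure.pi fun _ : ι => ν) ≤ 1 := by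
    calc ∫⁻ x, (∏ i, f (x i)) / ∏ i, g (x i) ∂(Measure.pi fun _ : ι => ν)
        = ∫⁻ x, ∏ i, f (x i) / g (x i) ∂(Measure.pi fun _ : ι => ν) := by
          refine lintegral_congr_ae ?_
          filter_upwards [hae] with x hx
          simp only [div_eq_mul_inv, Finset.prod_mul_distrib]
          rw [ENNReal.prod_inv_distrib fun i _ j _ _ => Or.inr (hx j)]
      _ = ∏ _i : ι, ∫⁻ y, f y / g y ∂ν :=
          lintegral_pi_prod_eq_prod (fun _ => ν) fun _ => hf.div hg
      _ ≤ 1 := Finset.prod_le_one' fun _ _ => hfg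
  calc (Measure.pi fun _ : ι => ν) {x | c < (∏ i, f (x i)) / ∏ i, g (x i)}
      ≤ (Measure.pi fun _ : ι => ν) {x | c ≤ (∏ i, f (x i)) / ∏ i, g (x i)} :=
        measure_mono fun _ hx => (show c < _ from hx).le
    _ ≤ (∫⁻ x, (∏ i, f (x i)) / ∏ i, g (x i) ∂(Measure.pi fun _ : ι => ν)) / c :=
        meas_ge_le_lintegral_div (by fun_prop) hc hc_top
    _ ≤ 1 / c := by gcongr
    _ = c⁻¹ := one_div c

/-- **RIPR split LRT.** Let `Θ₀ ⊆ Θ` generate a convex family of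
densities.  Let `θ̂₁ = hat1 D₁` be an estimator measurable in `D₁`, and let
`p₀* = p0star D₁` be a density (measurable as a function of `D₁`) satisfying the reversed
information projection inequality `E_{Y∼p_{θ₀}}[p_{θ̂₁}(Y)/p₀*(Y) ∣ D₁] ≤ 1` for every
`θ₀ ∈ Θ₀`.  Then the RIPR split LRT statistic `Rₙ = ∏_{i∈D₀} p_{θ̂₁}(Yᵢ)/p₀*(Yᵢ)`
satisfies `P_{θ₀}(Rₙ > 1/α) ≤ α` for every `θ₀ ∈ Θ₀`; moreover, whenever `p₀* D₁` equals
`p θ'` for some `θ' ∈ Θ₀`, one has `Rₙ ≥ Uₙ`, where `Uₙ = L₀(θ̂₁)/L₀(θ̂₀)` is the MLE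
split LRT statistic with `θ̂₀ = mle0 D₀` the null MLE on `D₀`. -/
theorem RIPR_split_LRT
    {𝒴 Θ : Type*} [MeasurableSpace 𝒴] [MeasurableSpace Θ]
    (μ : Measure 𝒴) [SigmaFinite μ] (n : ℕ)
    (p : Θ → 𝒴 → ℝ≥0∞) (hp_meas : Measurable (Function.uncurry p))
    (hp1 : ∀ θ, ∫⁻ y, p θ y ∂μ = 1)
    [∀ θ, IsProbabilityMeasure (μ.withDensity (p θ))]
    (Θ₀ : Set Θ)
    (hconv : ∀ θ₁ ∈ Θ₀, ∀ θ₂ ∈ Θ₀, ∀ t : ℝ, 0 ≤ t → t ≤ 1 →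
      ∃ θ₃ ∈ Θ₀, ∀ y, p θ₃ y = ENNReal.ofReal t * p θ₁ y + ENNReal.ofReal (1 - t) * p θ₂ y)
    (hat1 : (Fin n → 𝒴) → Θ) (hhat1 : Measurable hat1)
    (p0star : (Fin n → 𝒴) → 𝒴 → ℝ≥0∞)
    (hp0star_meas : Measurable (fun x : (Fin n → 𝒴) × 𝒴 => p0star x.1 x.2))
    (hp0star_dens : ∀ d : Fin n → 𝒴, ∫⁻ y, p0star d y ∂μ = 1)
    (hRIPR : ∀ d₁ : Fin n → 𝒴, ∀ θ₀ ∈ Θ₀,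
      ∫⁻ y, (p (hat1 d₁) y / p0star d₁ y) * p θ₀ y ∂μ ≤ 1)
    (mle0 : (Fin n → 𝒴) → Θ)
    (hmle0_mem : ∀ d : Fin n → 𝒴, mle0 d ∈ Θ₀)
    (hmle0_max : ∀ d : Fin n → 𝒴, ∀ θ ∈ Θ₀, (∏ i, p θ (d i)) ≤ ∏ i, p (mle0 d) (d i))
    (α : ℝ) (hα : α ∈ Set.Ioo (0 : ℝ) 1) :
    (∀ θ₀ ∈ Θ₀,
      ((Measure.pi fun _ : Fin n => μ.withDensity (p θ₀)).prod
          (Measure.pi fun _ : Fin n => μ.withDensity (p θ₀)))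
          {ω : (Fin n → 𝒴) × (Fin n → 𝒴) |
            ENNReal.ofReal (1 / α) <
              (∏ i, p (hat1 ω.2) (ω.1 i)) / (∏ i, p0star ω.2 (ω.1 i))}
        ≤ ENNReal.ofReal α) ∧
    (∀ d₁ : Fin n → 𝒴, ∀ θ' ∈ Θ₀, p0star d₁ = p θ' →
      ∀ d₀ : Fin n → 𝒴,
        (∏ i, p (hat1 d₁) (d₀ i)) / (∏ i, p (mle0 d₀) (d₀ i))
          ≤ (∏ i, p (hat1 d₁) (d₀ i)) / (∏ i, p0star d₁ (d₀ i))) := by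
  refine ⟨fun θ₀ hθ₀ => ?_, fun d₁ θ' hθ' h d₀ => ?_⟩
  · have hp : ∀ θ, Measurable (p θ) := fun θ => hp_meas.of_uncurry_left
    have hstar : ∀ d, Measurable (p0star d) := fun d => hp0star_meas.comp measurable_prodMk_left
    have hnum (i : Fin n) : Measurable fun ω : (Fin n → 𝒴) × (Fin n → 𝒴) =>
        p (hat1 ω.2) (ω.1 i) :=
      hp_meas.comp ((hhat1.comp measurable_snd).prodMk
        ((measurable_pi_apply i).comp measurable_fst))
    have hden (i : Fin n) : Measurable fun ω : (Fin n → 𝒴) × (Fin n → 𝒴) =>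
        p0star ω.2 (ω.1 i) :=
      hp0star_meas.comp (measurable_snd.prodMk ((measurable_pi_apply i).comp measurable_fst))
    have hα0 : 0 < 1 / α := one_div_pos.2 hα.1
    have hc : (ENNReal.ofReal (1 / α))⁻¹ = ENNReal.ofReal α := by
      rw [← ENNReal.ofReal_inv_of_pos hα0, one_div, inv_inv]
    have hset : MeasurableSet {ω : (Fin n → 𝒴) × (Fin n → 𝒴) | ENNReal.ofReal (1 / α) <
        (∏ i, p (hat1 ω.2) (ω.1 i)) / ∏ i, p0star ω.2 (ω.1 i)} :=
      measurableSet_lt measurable_const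
        ((Finset.measurable_fun_prod _ fun i _ => hnum i).div
          (Finset.measurable_fun_prod _ fun i _ => hden i))
    rw [Measure.prod_apply_symm hset, ← hc]
    refine (lintegral_mono fun d₁ => ?_).trans_eq
      ((lintegral_const _).trans (by rw [measure_univ, mul_one]))
    refine measure_pi_lt_prod_div_prod_le _ (hp (hat1 d₁)) (hstar d₁) ?_ ?_
      (ENNReal.ofReal_pos.2 hα0).ne' ENNReal.ofReal_ne_top
    · refine (withDensity_absolutelyContinuous μ (p θ₀)).ae_le ?_
      filter_upwards [ae_lt_top (hstar d₁) (by simp [hp0star_dens])] with y hy using hy.ne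
    · refine (lintegral_withDensity_eq_lintegral_mul μ (hp θ₀)
        ((hp (hat1 d₁)).div (hstar d₁))).trans_le ?_
      simpa only [Pi.mul_apply, Pi.div_apply, mul_comm] using hRIPR d₁ θ₀ hθ₀
  · rw [h]
    exact ENNReal.div_le_div_left (hmle0_max d₀ θ' hθ') _
end
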